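/- Lemma 3.5: Let μ̌ be an S-invariant Borel probability measure on Y whose fibers are (ā_n)-shrunk on average with respect to μ̌, let T be continuous, for each k let ω_{T^k} be a modulus of continuity of T^k (i.e. d(T^k x, T^k x') ≤ ω_{T^k}(d(x,x')) for all x,x' ∈ X), assume π induces a continuous fibration with modulus ω̄_π, and let μ be the unique T-invariant lift of μ̌. Then for all k, ℓ ∈ ℕ and every Borel probability measure ν on X: Wd(T^{k+ℓ}_*ν, μ) ≤ ω_{T^k}(ω̄_π(Wd(S^ℓ_*(π_*ν), μ̌))) + ā_k, where for probability measures on a compact metric space Wd(μ₀,μ₁) := sup{ |∫f dμ₀ − ∫f dμ₁| : f real-valued 1-Lipschitz } is the (Kantorovich-dual) Wasserstein distance. -/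

import Mathlib

open MeasureTheory Filter Topology Metric Set

/-- A modulus of continuity: continuous, increasing, concave on `[0,∞)`, vanishing at `0`. -/
def IsModulus (ω : ℝ → ℝ) : Prop :=
  ContinuousOn ω (Set.Ici 0) ∧ MonotoneOn ω (Set.Ici 0) ∧
    ConcaveOn ℝ (Set.Ici 0) ω ∧ ω 0 = 0 ∧ ∀ r ∈ Set.Ici (0 : ℝ), 0 ≤ ω r

/-- `T` is uniformly continuous along the fibers of `π`. -/
def UnifContAlongFibers {X Y : Type*} [PseudoMetricSpace X] (T : X → X) (π : X → Y) : Prop :=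
  ∃ ω : ℝ → ℝ, IsModulus ω ∧ ∀ x x' : X, π x = π x' → dist (T x) (T x') ≤ ω (dist x x')

/-- The fibers of `π` are `(a n)`-shrunk on average by `T` with respect to `ν`. -/
def ShrunkOnAverage {X Y : Type*} [PseudoMetricSpace X] [MeasurableSpace Y]
    (T : X → X) (π : X → Y) (ν : MeasureTheory.Measure Y) (a : ℕ → ℝ) : Prop :=
  UnifContAlongFibers T π ∧ (∀ n, 0 < a n) ∧ Filter.Tendsto a Filter.atTop (nhds 0) ∧
    ∀ n : ℕ, (∫ y, Metric.diam (T^[n] '' (π ⁻¹' {y})) ∂ν) ≤ a n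

/-- The Wasserstein distance between two measures, in its Kantorovich dual formulation:
the supremum, over real-valued `1`-Lipschitz functions, of the difference of integrals. -/
noncomputable def Wd {α : Type*} [PseudoMetricSpace α] [MeasurableSpace α]
    (μ₀ μ₁ : MeasureTheory.Measure α) : ℝ :=
  ⨆ f : {f : α → ℝ // LipschitzWith 1 f}, |(∫ x, f.1 x ∂μ₀) - ∫ x, f.1 x ∂μ₁|

theorem IsModulus.comp {ω₁ ω₂ : ℝ → ℝ} (h₁ : IsModulus ω₁) (h₂ : IsModulus ω₂) :
    IsModulus (fun r => ω₁ (ω₂ r)) := by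
  obtain ⟨c₁, m₁, k₁, z₁, p₁⟩ := h₁
  obtain ⟨c₂, m₂, k₂, z₂, p₂⟩ := h₂
  refine ⟨c₁.comp c₂ p₂, m₁.comp m₂ p₂, ⟨convex_Ici 0, ?_⟩, by simp [z₁, z₂],
    fun r hr => p₁ _ (p₂ r hr)⟩
  intro x hx y hy a b ha hb hab
  refine (k₁.2 (p₂ x hx) (p₂ y hy) ha hb hab).trans (m₁ ?_ ?_ (k₂.2 hx hy ha hb hab))
  · exact convex_Ici (0 : ℝ) (p₂ x hx) (p₂ y hy) ha hb hab
  · exact p₂ _ (convex_Ici (0 : ℝ) hx hy ha hb hab)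

/-- A modulus of continuity has a nonnegative supergradient at every positive point. -/
theorem IsModulus.exists_supergradient {ω : ℝ → ℝ} (h : IsModulus ω) {t : ℝ} (ht : 0 < t) :
    ∃ s : ℝ, 0 ≤ s ∧ ∀ r, 0 ≤ r → ω r ≤ ω t + s * (r - t) := by
  obtain ⟨-, hm, hc, -, -⟩ := h
  have slope_le : ∀ r, 0 ≤ r → r < t → ∀ u : Ioi t,
      (ω u - ω t) / (u - t) ≤ (ω t - ω r) / (t - r) := fun r hr hrt u =>
    hc.slope_anti_adjacent hr (ht.le.trans (le_of_lt u.2)) hrt u.2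
  have hne : Nonempty (Ioi t) := ⟨⟨t + 1, by simp⟩⟩
  have hbdd : BddAbove (range fun u : Ioi t => (ω u - ω t) / (u - t)) := by
    exact ⟨_, forall_mem_range.2 (slope_le 0 le_rfl ht)⟩
  refine ⟨⨆ u : Ioi t, (ω u - ω t) / (u - t), ?_, fun r hr => ?_⟩
  · refine Real.iSup_nonneg fun u => ?_
    have hu : t < u := u.2
    exact div_nonneg (sub_nonneg.2 (hm ht.le (ht.le.trans hu.le) hu.le)) (sub_nonneg.2 hu.le)
  · rcases lt_trichotomy r t with hrt | rfl | hrt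
    · have := ciSup_le (slope_le r hr hrt)
      rw [le_div_iff₀ (sub_pos.2 hrt)] at this
      linarith
    · simp
    · have := le_ciSup hbdd ⟨r, hrt⟩
      rw [div_le_iff₀ (sub_pos.2 hrt)] at this
      linarith

/-- A function satisfying a one-sided estimate with a modulus vanishing at `0` is continuous. -/
theorem continuous_of_le_add_modulus {α : Type*} [PseudoMetricSpace α] {h : α → ℝ} {ω : ℝ → ℝ}
    (hω : ContinuousOn ω (Ici 0)) (hω0 : ω 0 = 0)
    (hh : ∀ x y, h x ≤ h y + ω (dist x y)) : Continuous h := by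
  refine continuous_iff_continuousAt.2 fun x => tendsto_iff_dist_tendsto_zero.2 ?_
  have hlim : Tendsto (fun y => ω (dist y x)) (𝓝 x) (𝓝 0) := by
    have h0 : Tendsto ω (𝓝[Ici 0] 0) (𝓝 0) := by
      simpa [hω0] using (hω 0 self_mem_Ici).tendsto
    refine h0.comp (tendsto_nhdsWithin_iff.2 ⟨?_, Eventually.of_forall fun y => dist_nonneg⟩)
    exact tendsto_iff_dist_tendsto_zero.1 tendsto_id
  refine squeeze_zero (fun _ => dist_nonneg) (fun y => ?_) hlim
  have h₁ := hh y x
  have h₂ := hh x y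
  rw [dist_comm x y] at h₂
  rw [Real.dist_eq, abs_le]
  constructor <;> linarith

theorem wd_nonneg {α : Type*} [PseudoMetricSpace α] [MeasurableSpace α]
    (μ₀ μ₁ : Measure α) : 0 ≤ Wd μ₀ μ₁ :=
  Real.iSup_nonneg fun _ => abs_nonneg _

section Compact

variable {α : Type*} [MetricSpace α] [CompactSpace α] [MeasurableSpace α] [BorelSpace α]

theorem Continuous.integrable_of_compactSpace {f : α → ℝ} (hf : Continuous f)
    (μ : Measure α) [IsFiniteMeasure μ] : Integrable f μ :=
  hf.integrable_of_hasCompactSupport (HasCompactSupport.of_compactSpace f)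

theorem bddAbove_range_wd (μ₀ μ₁ : Measure α) [IsProbabilityMeasure μ₀]
    [IsProbabilityMeasure μ₁] :
    BddAbove (range fun f : {f : α → ℝ // LipschitzWith 1 f} =>
      |(∫ x, f.1 x ∂μ₀) - ∫ x, f.1 x ∂μ₁|) := by
  obtain ⟨x₀⟩ : Nonempty α := nonempty_of_isProbabilityMeasure μ₀
  have key : ∀ (μ : Measure α) [IsProbabilityMeasure μ] (f : α → ℝ), LipschitzWith 1 f →
      |(∫ x, f x ∂μ) - f x₀| ≤ diam (univ : Set α) := by
    intro μ _ f hf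
    have hint := hf.continuous.integrable_of_compactSpace μ
    have : (∫ x, f x ∂μ) - f x₀ = ∫ x, (f x - f x₀) ∂μ := by
      rw [integral_sub hint (integrable_const _)]
      simp
    rw [this, ← Real.norm_eq_abs]
    refine (norm_integral_le_of_norm_le_const (C := diam (univ : Set α))
      (Eventually.of_forall fun x => ?_)).trans (by simp)
    have h₁ := hf.dist_le_mul x x₀
    rw [NNReal.coe_one, one_mul] at h₁
    exact (Real.dist_eq _ _).symm.le.trans
      (h₁.trans (dist_le_diam_of_mem isCompact_univ.isBounded (mem_univ _) (mem_univ _)))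
  refine ⟨diam (univ : Set α) + diam (univ : Set α), ?_⟩
  rintro _ ⟨f, rfl⟩
  have h₀ := abs_le.1 (key μ₀ f.1 f.2)
  have h₁ := abs_le.1 (key μ₁ f.1 f.2)
  refine abs_le.2 ⟨?_, ?_⟩ <;> linarith

theorem LipschitzWith.integral_sub_le_mul_wd {f : α → ℝ} {K : NNReal} (hf : LipschitzWith K f)
    (μ₀ μ₁ : Measure α) [IsProbabilityMeasure μ₀] [IsProbabilityMeasure μ₁] :
    (∫ x, f x ∂μ₀) - ∫ x, f x ∂μ₁ ≤ K * Wd μ₀ μ₁ := by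
  rcases eq_or_ne K 0 with rfl | hK
  · obtain ⟨x₀⟩ : Nonempty α := nonempty_of_isProbabilityMeasure μ₀
    have hconst : f = fun _ => f x₀ := funext fun x =>
      dist_le_zero.1 (by simpa using hf.dist_le_mul x x₀)
    rw [hconst]
    simp
  · have hK' : (0 : ℝ) < K := NNReal.coe_pos.2 (pos_iff_ne_zero.2 hK)
    have hg : LipschitzWith 1 fun x => (K : ℝ)⁻¹ * f x := by
      refine LipschitzWith.of_dist_le_mul fun x y => ?_
      rw [Real.dist_eq, ← mul_sub, abs_mul, abs_of_pos (inv_pos.2 hK'), ← Real.dist_eq,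
        NNReal.coe_one, one_mul, inv_mul_le_iff₀ hK']
      exact hf.dist_le_mul x y
    have h := (le_abs_self _).trans (le_ciSup (bddAbove_range_wd μ₀ μ₁) ⟨_, hg⟩)
    simp only [integral_const_mul, ← mul_sub] at h
    rwa [inv_mul_le_iff₀ hK'] at h

/-- Integrals of a function with concave modulus of continuity `ω` differ by at most `ω` of the
Wasserstein distance. -/
theorem IsModulus.integral_sub_le_wd {ω : ℝ → ℝ} (hω : IsModulus ω) {g : α → ℝ}
    (hg : ∀ x y, g x ≤ g y + ω (dist x y))
    (μ₀ μ₁ : Measure α) [IsProbabilityMeasure μ₀] [IsProbabilityMeasure μ₁] :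
    (∫ x, g x ∂μ₀) - ∫ x, g x ∂μ₁ ≤ ω (Wd μ₀ μ₁) := by
  have hgc : Continuous g := continuous_of_le_add_modulus hω.1 hω.2.2.2.1 hg
  have : Nonempty α := nonempty_of_isProbabilityMeasure μ₀
  set W := Wd μ₀ μ₁ with hW
  have hW0 : 0 ≤ W := wd_nonneg μ₀ μ₁
  have key : ∀ t ∈ Ioi W, (∫ x, g x ∂μ₀) - ∫ x, g x ∂μ₁ ≤ ω t := by
    intro t ht
    obtain ⟨s, hs, hst⟩ := hω.exists_supergradient (hW0.trans_lt ht)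
    -- the smallest `s`-Lipschitz majorant of `g`
    let H : α → ℝ := fun x => ⨆ y, (g y - s * dist x y)
    have hle : ∀ x y, g y - s * dist x y ≤ g x + (ω t - s * t) := by
      intro x y
      have h₁ := hg y x
      have h₂ := hst (dist y x) dist_nonneg
      rw [dist_comm y x] at h₁ h₂
      linarith
    have hbdd : ∀ x, BddAbove (range fun y => g y - s * dist x y) := fun x =>
      ⟨_, forall_mem_range.2 (hle x)⟩
    have hHg : ∀ x, H x ≤ g x + (ω t - s * t) := fun x => ciSup_le (hle x)
    have hgH : ∀ x, g x ≤ H x := fun x => by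
      simpa using le_ciSup (hbdd x) x
    have hH : LipschitzWith s.toNNReal H := by
      refine LipschitzWith.of_le_add_mul _ fun x y => ciSup_le fun z => ?_
      have h₁ := le_ciSup (hbdd y) z
      have h₂ := mul_le_mul_of_nonneg_left (dist_triangle y x z) hs
      rw [dist_comm y x] at h₂
      rw [Real.coe_toNNReal s hs]
      change _ ≤ H y + _
      change _ ≤ H y at h₁
      linarith
    have hHi := fun (μ : Measure α) [IsProbabilityMeasure μ] =>
      hH.continuous.integrable_of_compactSpace μ
    have hgi := fun (μ : Measure α) [IsProbabilityMeasure μ] => hgc.integrable_of_compactSpace μ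
    have h₀ := integral_mono (hgi μ₀) (hHi μ₀) hgH
    have h₁ := integral_mono (hHi μ₁) ((hgi μ₁).add (integrable_const (ω t - s * t))) hHg
    simp only [Pi.add_apply] at h₁
    rw [integral_add (hgi μ₁) (integrable_const _)] at h₁
    simp only [integral_const, probReal_univ, one_smul] at h₁
    have h₂ := hH.integral_sub_le_mul_wd μ₀ μ₁
    rw [Real.coe_toNNReal s hs, ← hW] at h₂
    have h₃ := mul_le_mul_of_nonneg_left (le_of_lt ht) hs
    linarith
  have hlim : Tendsto ω (𝓝[>] W) (𝓝 (ω W)) :=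
    (hω.1 W hW0).tendsto.mono_left
      (nhdsWithin_mono _ fun t ht => hW0.trans (le_of_lt ht))
  exact ge_of_tendsto hlim (eventually_nhdsWithin_of_forall key)

end Compact

/-- For `f` `1`-Lipschitz, the integrals of `f ∘ R` against two measures are compared through their
projections to the base, up to the average diameter of the images of the fibers under `R`. -/
theorem integral_comp_sub_le_of_fibration
    {X Y : Type*} [MetricSpace X] [CompactSpace X] [MeasurableSpace X] [BorelSpace X]
    [MetricSpace Y] [CompactSpace Y] [MeasurableSpace Y] [BorelSpace Y]
    {R : X → X} {π : X → Y} (hπc : Continuous π) (hπs : Function.Surjective π)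
    (hRc : Continuous R) {ωR ωπ : ℝ → ℝ} (hωR : IsModulus ωR) (hωπ : IsModulus ωπ)
    (hR : ∀ x x', dist (R x) (R x') ≤ ωR (dist x x'))
    (hfib : ∀ y y' : Y, ∀ x ∈ π ⁻¹' {y}, ∃ x' ∈ π ⁻¹' {y'}, dist x x' ≤ ωπ (dist y y'))
    (ν μ : Measure X) [IsProbabilityMeasure ν] [IsProbabilityMeasure μ]
    {f : X → ℝ} (hf : LipschitzWith 1 f) :
    (∫ x, f (R x) ∂ν) - ∫ x, f (R x) ∂μ ≤
      ωR (ωπ (Wd (Measure.map π ν) (Measure.map π μ))) +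
        ∫ y, diam (R '' (π ⁻¹' {y})) ∂(Measure.map π μ) := by
  have hω := hωR.comp hωπ
  have hne : ∀ y, Nonempty (π ⁻¹' {y}) := fun y => (hπs y).elim fun x hx => ⟨⟨x, hx⟩⟩
  have hνp := Measure.isProbabilityMeasure_map (μ := ν) hπc.aemeasurable
  have hμp := Measure.isProbabilityMeasure_map (μ := μ) hπc.aemeasurable
  have hlift : ∀ y y' : Y, ∀ x ∈ π ⁻¹' {y}, ∃ x' ∈ π ⁻¹' {y'},
      dist (R x) (R x') ≤ ωR (ωπ (dist y y')) := by
    intro y y' x hx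
    obtain ⟨x', hx', hd⟩ := hfib y y' x hx
    exact ⟨x', hx', (hR x x').trans
      (hωR.2.1 dist_nonneg (hωπ.2.2.2.2 _ dist_nonneg) hd)⟩
  have hfd : ∀ x x', f x ≤ f x' + dist x x' := fun x x' => by
    simpa using hf.le_add_mul x x'
  have hbounded : ∀ s : Set X, Bornology.IsBounded s := fun s =>
    isCompact_univ.isBounded.subset (subset_univ s)
  let D : Y → ℝ := fun y => diam (R '' (π ⁻¹' {y}))
  have hDdist : ∀ y, ∀ x ∈ π ⁻¹' {y}, ∀ x' ∈ π ⁻¹' {y}, dist (R x) (R x') ≤ D y :=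
    fun y x hx x' hx' => dist_le_diam_of_mem (hbounded _)
      (mem_image_of_mem R hx) (mem_image_of_mem R hx')
  have hDc : Continuous D := by
    refine continuous_of_le_add_modulus (ω := fun r => 2 * ωR (ωπ r))
      (continuousOn_const.mul hω.1) (by simp [hω.2.2.2.1]) fun y y' => ?_
    have hpos := hω.2.2.2.2 (dist y y') dist_nonneg
    refine diam_le_of_forall_dist_le (add_nonneg diam_nonneg (by positivity)) ?_
    rintro _ ⟨p, hp, rfl⟩ _ ⟨q, hq, rfl⟩
    obtain ⟨p', hp', hpd⟩ := hlift y y' p hp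
    obtain ⟨q', hq', hqd⟩ := hlift y y' q hq
    have h₁ := dist_triangle4 (R p) (R p') (R q') (R q)
    have h₂ := hDdist y' p' hp' q' hq'
    rw [dist_comm (R q') (R q)] at h₁
    linarith
  let G : Y → ℝ := fun y => ⨆ x : π ⁻¹' {y}, f (R x)
  have hfRc : Continuous fun x => f (R x) := hf.continuous.comp hRc
  have hbdd : ∀ y, BddAbove (range fun x : π ⁻¹' {y} => f (R x)) := fun y =>
    (isCompact_range hfRc).bddAbove.mono (range_subset_iff.2 fun x => mem_range_self x.1)
  have hG : ∀ y y', G y ≤ G y' + ωR (ωπ (dist y y')) := by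
    refine fun y y' => ciSup_le fun x => ?_
    obtain ⟨x', hx', hd⟩ := hlift y y' x x.2
    have h₁ : f (R x') ≤ G y' := le_ciSup (hbdd y') ⟨x', hx'⟩
    have h₂ := hfd (R x) (R x')
    linarith
  have hGc : Continuous G := continuous_of_le_add_modulus hω.1 hω.2.2.2.1 hG
  have hfG : ∀ x, f (R x) ≤ G (π x) := fun x => le_ciSup (hbdd (π x)) ⟨x, rfl⟩
  have hGf : ∀ x, G (π x) ≤ f (R x) + D (π x) := fun x => ciSup_le fun x' =>
    (hfd _ _).trans (add_le_add_right (hDdist (π x) x' x'.2 x rfl) _)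
  have h₀ := integral_mono (hfRc.integrable_of_compactSpace ν)
    ((hGc.comp hπc).integrable_of_compactSpace ν) hfG
  have h₁ := integral_mono ((hGc.comp hπc).integrable_of_compactSpace μ)
    ((hfRc.integrable_of_compactSpace μ).add ((hDc.comp hπc).integrable_of_compactSpace μ)) hGf
  simp only [Pi.add_apply] at h₁
  rw [integral_add (hfRc.integrable_of_compactSpace μ)
    ((hDc.comp hπc).integrable_of_compactSpace μ)] at h₁
  have h₂ := hω.integral_sub_le_wd hG (Measure.map π ν) (Measure.map π μ)
  rw [integral_map hπc.aemeasurable hGc.aestronglyMeasurable,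
    integral_map hπc.aemeasurable hGc.aestronglyMeasurable] at h₂
  rw [integral_map hπc.aemeasurable hDc.aestronglyMeasurable]
  simp only [Function.comp_apply, D] at h₀ h₁ h₂ ⊢
  linarith

/-- Lemma 3.5: quantitative comparison of the push-forwards `T^{k+ℓ}_* ν` with the unique
invariant lift `μ` of `μY`, in terms of the Wasserstein distance of `S^ℓ_*(π_* ν)` to `μY`. -/
theorem wasserstein_estimate_of_iterates
    {X Y : Type*} [MetricSpace X] [CompactSpace X] [MeasurableSpace X] [BorelSpace X]
    [MetricSpace Y] [CompactSpace Y] [MeasurableSpace Y] [BorelSpace Y]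
    (T : X → X) (S : Y → Y) (π : X → Y)
    (hT : Measurable T) (hS : Measurable S) (hTc : Continuous T)
    (hπc : Continuous π) (hπs : Function.Surjective π)
    (hcomm : ∀ x, π (T x) = S (π x))
    (μY : Measure Y) [IsProbabilityMeasure μY] (hμYinv : Measure.map S μY = μY)
    (a : ℕ → ℝ) (hshrink : ShrunkOnAverage T π μY a)
    (ωT : ℕ → ℝ → ℝ) (hωTmod : ∀ k, IsModulus (ωT k))
    (hωT : ∀ (k : ℕ) (x x' : X), dist (T^[k] x) (T^[k] x') ≤ ωT k (dist x x'))
    (ωπ : ℝ → ℝ) (hωπmod : IsModulus ωπ)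
    (hfib : ∀ y y' : Y, ∀ x ∈ π ⁻¹' {y}, ∃ x' ∈ π ⁻¹' {y'}, dist x x' ≤ ωπ (dist y y'))
    (μ : Measure X) [IsProbabilityMeasure μ]
    (hμinv : Measure.map T μ = μ) (hμlift : Measure.map π μ = μY)
    (ν : Measure X) [IsProbabilityMeasure ν] (k ℓ : ℕ) :
    Wd (Measure.map T^[k + ℓ] ν) μ ≤
      ωT k (ωπ (Wd (Measure.map S^[ℓ] (Measure.map π ν)) μY)) + a k := by
  have hTk : MeasurePreserving T^[k] μ μ := MeasurePreserving.iterate ⟨hT, hμinv⟩ k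
  have hbase : Measure.map S^[ℓ] (Measure.map π ν) = Measure.map π (Measure.map T^[ℓ] ν) := by
    rw [Measure.map_map (hS.iterate ℓ) hπc.measurable,
      Measure.map_map hπc.measurable (hT.iterate ℓ)]
    congr 1
    exact (Function.Semiconj.comp_eq (Function.Semiconj.iterate_right hcomm ℓ)).symm
  have hνp := Measure.isProbabilityMeasure_map (μ := ν) (hT.iterate ℓ).aemeasurable
  have hak := hshrink.2.2.2 k
  have key : ∀ f : X → ℝ, LipschitzWith 1 f →
      (∫ x, f x ∂(Measure.map T^[k + ℓ] ν)) - ∫ x, f x ∂μ ≤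
        ωT k (ωπ (Wd (Measure.map S^[ℓ] (Measure.map π ν)) μY)) + a k := by
    intro f hf
    have h := integral_comp_sub_le_of_fibration hπc hπs (hTc.iterate k) (hωTmod k) hωπmod
      (hωT k) hfib (Measure.map T^[ℓ] ν) μ hf
    rw [hμlift, ← hbase] at h
    have hfm : ∀ m : Measure X, AEStronglyMeasurable f m := fun m =>
      hf.continuous.aestronglyMeasurable
    rw [← integral_map (hT.iterate k).aemeasurable (hfm _),
      ← integral_map (hT.iterate k).aemeasurable (hfm _), hTk.map_eq,
      Measure.map_map (hT.iterate k) (hT.iterate ℓ), ← Function.iterate_add] at h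
    linarith
  have : Nonempty {f : X → ℝ // LipschitzWith 1 f} := ⟨⟨fun _ => 0, LipschitzWith.const' 0⟩⟩
  refine ciSup_le fun f => abs_le'.2 ⟨key f.1 f.2, ?_⟩
  have h := key (fun x => -f.1 x) f.2.neg
  simp only [integral_neg] at h
  linarith
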